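/- Let x_0 ∈ A and let p be an extreme point of ∂⁻u(x_0) with p ∈ [b_i, b_{i+1}] for some i ∈ {1,…,m}. Then ∂⁻u(x_0) ∩ [b_i, b_{i+1}] = {p}, i.e. ∂⁻u(x_0) ∩ [b_i, b_{i+1}] \ {p} = ∅. -/

import Mathlib

open MeasureTheory Metric Set
open scoped NNReal ENNReal RealInnerProductSpace

noncomputable section

abbrev E2 : Type := EuclideanSpace ℝ (Fin 2)

/-- The subdifferential of a convex function `w` at a point `x`. -/
def subdiff (w : E2 → ℝ) (x : E2) : Set E2 :=
  {p : E2 | ∀ z : E2, w x + ⟪p, z - x⟫ ≤ w z}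

theorem gradient_mem_subdiff {u : E2 → ℝ} (hconv : ConvexOn ℝ Set.univ u) {x : E2}
    (hx : DifferentiableAt ℝ u x) : gradient u x ∈ subdiff u x := by
  intro z
  have hline : ConvexOn ℝ univ (fun t : ℝ => u (AffineMap.lineMap x z t)) :=
    hconv.comp_affineMap (AffineMap.lineMap (k := ℝ) x z)
  have hder : HasDerivAt (fun t : ℝ => u (AffineMap.lineMap x z t)) ⟪gradient u x, z - x⟫ 0 := by
    have h1 : HasFDerivAt u (InnerProductSpace.toDual ℝ E2 (gradient u x))
        (AffineMap.lineMap x z (0 : ℝ)) := by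
      simpa using hx.hasGradientAt.hasFDerivAt
    exact h1.comp_hasDerivAt (0 : ℝ) AffineMap.hasDerivAt_lineMap
  have := hline.le_slope_of_hasDerivAt (mem_univ 0) (mem_univ 1) zero_lt_one hder
  rw [slope_def_field, AffineMap.lineMap_apply_one, AffineMap.lineMap_apply_zero] at this
  linarith

theorem real_inner_eq_add (B : OrthonormalBasis (Fin 2) ℝ E2) (x y : E2) :
    ⟪x, y⟫ = ⟪B 0, x⟫ * ⟪B 0, y⟫ + ⟪B 1, x⟫ * ⟪B 1, y⟫ := by
  rw [← B.sum_inner_mul_inner x y, Fin.sum_univ_two, real_inner_comm (B 0) x,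
    real_inner_comm (B 1) x]

theorem norm_le_abs_inner_add (B : OrthonormalBasis (Fin 2) ℝ E2) (x : E2) :
    ‖x‖ ≤ |⟪B 0, x⟫| + |⟪B 1, x⟫| := by
  refine abs_le_of_sq_le_sq' ?_ (by positivity) |>.2
  have := real_inner_eq_add B x x
  rw [real_inner_self_eq_norm_sq] at this
  nlinarith [abs_nonneg ⟪B 0, x⟫, abs_nonneg ⟪B 1, x⟫, sq_abs ⟪B 0, x⟫, sq_abs ⟪B 1, x⟫,
    mul_nonneg (abs_nonneg ⟪B 0, x⟫) (abs_nonneg ⟪B 1, x⟫)]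

theorem volume_inner_mem_box (B : OrthonormalBasis (Fin 2) ℝ E2) {I J : Set ℝ}
    (hI : MeasurableSet I) (hJ : MeasurableSet J) :
    volume {x : E2 | ⟪B 0, x⟫ ∈ I ∧ ⟪B 1, x⟫ ∈ J} = volume I * volume J := by
  have hm := (PiLp.volume_preserving_ofLp (Fin 2)).comp B.measurePreserving_repr
  have hset : {x : E2 | ⟪B 0, x⟫ ∈ I ∧ ⟪B 1, x⟫ ∈ J}
      = (WithLp.ofLp ∘ B.repr) ⁻¹' (univ.pi ![I, J]) := by
    ext x
    simp [Fin.forall_fin_two, B.repr_apply_apply]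
  rw [hset, hm.measure_preimage, volume_pi_pi]
  · simp
  · refine (MeasurableSet.univ_pi ?_).nullMeasurableSet
    simp [Fin.forall_fin_two, hI, hJ]

theorem exists_orthonormalBasis_eq {e n : E2} (he : ‖e‖ = 1) (hn : ‖n‖ = 1) (hen : ⟪e, n⟫ = 0) :
    ∃ B : OrthonormalBasis (Fin 2) ℝ E2, B 0 = e ∧ B 1 = n := by
  have ho : Orthonormal ℝ ![e, n] := by
    refine ⟨by simp [Fin.forall_fin_two, he, hn], ?_⟩
    intro i j hij
    fin_cases i <;> fin_cases j <;> simp_all [real_inner_comm]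
  obtain ⟨B, hB⟩ := Orthonormal.exists_orthonormalBasis_extension_of_card_eq (𝕜 := ℝ) (E := E2)
    (ι := Fin 2) (by simp) (v := ![e, n]) (s := univ) (ho.comp _ Subtype.val_injective)
  exact ⟨B, hB 0 (mem_univ _), hB 1 (mem_univ _)⟩

theorem subset_or_disjoint_of_disjoint_frontier {X : Type*} [TopologicalSpace X] {U S : Set X}
    (hU : IsOpen U) (hS : IsPreconnected S) (h : Disjoint S (frontier U)) :
    S ⊆ U ∨ Disjoint S U := by
  have hsub : S ⊆ U ∪ (closure U)ᶜ := by
    intro x hx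
    by_cases hxU : x ∈ U
    · exact Or.inl hxU
    · refine Or.inr fun hc => h.notMem_of_mem_left hx ?_
      rw [hU.frontier_eq]
      exact ⟨hc, hxU⟩
  have hd : Disjoint U (closure U)ᶜ :=
    disjoint_compl_right.mono_left subset_closure
  rcases hS.subset_or_subset hU isClosed_closure.isOpen_compl hd hsub with h1 | h1
  · exact Or.inl h1
  · exact Or.inr (hd.symm.mono_left h1)

/-- A segment meeting a level set of a linear functional in two points lies in that level set. -/
theorem inner_eq_zero_or_subsingleton (n w a c : E2) :
    (∀ y ∈ segment ℝ a c, ⟪n, y - w⟫ = 0) ∨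
      (segment ℝ a c ∩ {y | ⟪n, y - w⟫ = 0}).Subsingleton := by
  by_cases h : ⟪n, c - a⟫ = 0
  · by_cases h2 : ⟪n, a - w⟫ = 0
    · left
      rw [segment_eq_image']
      rintro _ ⟨θ, -, rfl⟩
      simp only [inner_sub_right, inner_add_right, inner_smul_right] at *
      linear_combination h2 + θ * h
    · right
      rw [segment_eq_image']
      rintro _ ⟨⟨θ, -, rfl⟩, hθ⟩
      exfalso; apply h2
      simp only [inner_sub_right, inner_add_right, inner_smul_right, mem_ofPred_eq] at *
      linear_combination hθ - θ * h
  · right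
    rw [segment_eq_image']
    rintro _ ⟨⟨θ, -, rfl⟩, hθ⟩ _ ⟨⟨η, -, rfl⟩, hη⟩
    have : (θ - η) * ⟪n, c - a⟫ = 0 := by
      simp only [inner_sub_right, inner_add_right, inner_smul_right, mem_ofPred_eq] at *
      linear_combination hθ - hη
    rcases mul_eq_zero.1 this with h1 | h1
    · rw [sub_eq_zero.1 h1]
    · exact absurd h1 h

/-- If `u` is affine with slope `z` along the segment from `x₀` to `x₀ + τ • B 1` and a segment
around `z` in direction `B 0` consists of subgradients at `x₀`, then subgradients at `x` are
monotone with respect to those at `x₀ + τ • B 1`. -/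
theorem inner_mul_add_inner_mul_nonneg {u : E2 → ℝ} (B : OrthonormalBasis (Fin 2) ℝ E2)
    {x₀ z x y : E2} {σ τ : ℝ} (hz : z + σ • B 0 ∈ subdiff u x₀)
    (hτ : u (x₀ + τ • B 1) - u x₀ - τ * ⟪B 1, z⟫ ≤ 0) (hy : y ∈ subdiff u x) :
    0 ≤ (⟪B 0, y - z⟫ - σ) * ⟪B 0, x - x₀⟫ + ⟪B 1, y - z⟫ * (⟪B 1, x - x₀⟫ - τ) := by
  have h1 := hz x
  have h2 := hy (x₀ + τ • B 1)
  have e0 : ⟪B 0, B 0⟫ = (1 : ℝ) := by simp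
  have e1 : ⟪B 1, B 1⟫ = (1 : ℝ) := by simp
  have e2 : ⟪B 0, B 1⟫ = (0 : ℝ) := B.orthonormal.2 (by decide)
  have e3 : ⟪B 1, B 0⟫ = (0 : ℝ) := B.orthonormal.2 (by decide)
  rw [real_inner_eq_add B] at h1 h2
  simp only [inner_sub_right, inner_add_right, inner_smul_right, e0, e1, e2, e3] at *
  linarith

theorem sub_le_of_mem_subdiff {u : E2 → ℝ} {K : ℝ≥0} (hLip : LipschitzWith K u)
    (B : OrthonormalBasis (Fin 2) ℝ E2) {x₀ z x y : E2} (hy : y ∈ subdiff u x) :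
    u (x₀ + ⟪B 1, x - x₀⟫ • B 1) - u x₀ - ⟪B 1, x - x₀⟫ * ⟪B 1, z⟫
      ≤ (K + |⟪B 0, y⟫|) * |⟪B 0, x - x₀⟫| + ⟪B 1, y - z⟫ * ⟪B 1, x - x₀⟫ := by
  have h1 := hy x₀
  have e1 : ⟪B 1, B 1⟫ = (1 : ℝ) := by simp
  have e2 : ⟪B 0, B 1⟫ = (0 : ℝ) := B.orthonormal.2 (by decide)
  have h2 : u (x₀ + ⟪B 1, x - x₀⟫ • B 1) - u x ≤ K * |⟪B 0, x - x₀⟫| := by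
    refine (le_abs_self _).trans ?_
    have h3 := hLip.dist_le_mul (x₀ + ⟪B 1, x - x₀⟫ • B 1) x
    rw [Real.dist_eq, dist_eq_norm] at h3
    refine h3.trans (mul_le_mul_of_nonneg_left ?_ K.2)
    refine (norm_le_abs_inner_add B _).trans (le_of_eq ?_)
    simp only [inner_sub_right, inner_add_right, inner_smul_right, e1, e2]
    rw [show ⟪B 1, x₀⟫ + (⟪B 1, x⟫ - ⟪B 1, x₀⟫) * 1 - ⟪B 1, x⟫ = (0 : ℝ) by ring, abs_zero,
      add_zero, ← abs_neg]
    congr 1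
    ring
  have h3 : ⟪B 0, y⟫ * ⟪B 0, x - x₀⟫ ≤ |⟪B 0, y⟫| * |⟪B 0, x - x₀⟫| := by
    rw [← abs_mul]; exact le_abs_self _
  rw [real_inner_eq_add B, ← neg_sub x x₀] at h1
  simp only [inner_neg_right] at h1
  rw [inner_sub_right (B 1) y z]
  linarith

/-- A segment of subgradients at a point cannot bound a half-ball inside the target domain. -/
theorem false_of_halfBall_subset {Ω Ωs : Set E2} (hΩb : Bornology.IsBounded Ω)
    {u : E2 → ℝ} (hconv : ConvexOn ℝ Set.univ u) {K : ℝ≥0} (hLip : LipschitzWith K u)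
    (hpush : ∀ E : Set E2, MeasurableSet E →
      volume {x ∈ Ω | DifferentiableAt ℝ u x ∧ gradient u x ∈ E} = volume (E ∩ Ωs))
    (B : OrthonormalBasis (Fin 2) ℝ E2) {x₀ z : E2} {δ r : ℝ} (hδ : 0 < δ) (hδr : δ < r / 2)
    (hz : ∀ σ : ℝ, |σ| ≤ 2 * δ → z + σ • B 0 ∈ subdiff u x₀)
    (hball : ∀ y ∈ ball z r, 0 < ⟪B 1, y - z⟫ → y ∈ Ωs) : False := by
  set φ : ℝ → ℝ := fun τ => u (x₀ + τ • B 1) - u x₀ - τ * ⟪B 1, z⟫ with hφ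
  set E : ℝ → Set E2 := fun h => {y | ⟪B 0, y⟫ ∈ Ioo (⟪B 0, z⟫ - δ) (⟪B 0, z⟫ + δ) ∧
    ⟪B 1, y⟫ ∈ Ioo ⟪B 1, z⟫ (⟪B 1, z⟫ + h)} with hE
  set G : ℝ → Set E2 :=
    fun h => {x ∈ Ω | DifferentiableAt ℝ u x ∧ gradient u x ∈ E h} with hG
  have hr : 0 < r := by linarith
  have hvolG : ∀ h, 0 < h → h ≤ r / 2 → volume (G h) = ENNReal.ofReal (2 * δ * h) := by
    intro h hh0 hhr
    have hEo : MeasurableSet (E h) := by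
      refine MeasurableSet.inter ?_ ?_
      · exact (isOpen_Ioo.preimage (by fun_prop : Continuous fun y : E2 => ⟪B 0, y⟫)).measurableSet
      · exact (isOpen_Ioo.preimage (by fun_prop : Continuous fun y : E2 => ⟪B 1, y⟫)).measurableSet
    have hsub : E h ⊆ Ωs := by
      rintro y ⟨⟨h1, h2⟩, h3, h4⟩
      refine hball y ?_ (by rw [inner_sub_right]; linarith)
      rw [mem_ball, dist_eq_norm]
      refine (norm_le_abs_inner_add B _).trans_lt ?_
      rw [inner_sub_right, inner_sub_right]
      have := abs_lt.2 (show -δ < ⟪B 0, y⟫ - ⟪B 0, z⟫ ∧ ⟪B 0, y⟫ - ⟪B 0, z⟫ < δ by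
        constructor <;> linarith)
      rw [abs_of_pos (by linarith : 0 < ⟪B 1, y⟫ - ⟪B 1, z⟫)]
      linarith
    rw [hG, hpush _ hEo, inter_eq_left.2 hsub, hE,
      volume_inner_mem_box B measurableSet_Ioo measurableSet_Ioo, Real.volume_Ioo, Real.volume_Ioo,
      ← ENNReal.ofReal_mul (by linarith)]
    congr 1
    ring
  have hmono : ∀ h, ∀ x ∈ G h, ∀ τ, φ τ ≤ 0 →
      τ ≤ ⟪B 1, x - x₀⟫ ∧ δ * |⟪B 0, x - x₀⟫| ≤ h * (⟪B 1, x - x₀⟫ - τ) := by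
    rintro h x ⟨-, hdx, ⟨h1, h2⟩, h3, h4⟩ τ hτ
    have hy := gradient_mem_subdiff hconv hdx
    set y := gradient u x
    have hs : |⟪B 0, y - z⟫| < δ := by
      rw [inner_sub_right, abs_lt]
      constructor <;> linarith
    rw [abs_lt] at hs
    have ht : 0 < ⟪B 1, y - z⟫ ∧ ⟪B 1, y - z⟫ < h := by
      rw [inner_sub_right]
      constructor <;> linarith
    have key := fun σ hσ => inner_mul_add_inner_mul_nonneg B (hz σ hσ) hτ hy
    have k0 := key ⟪B 0, y - z⟫ (abs_le.2 ⟨by linarith, by linarith⟩)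
    have k1 := key (⟪B 0, y - z⟫ + δ) (abs_le.2 ⟨by linarith, by linarith⟩)
    have k2 := key (⟪B 0, y - z⟫ - δ) (abs_le.2 ⟨by linarith, by linarith⟩)
    have hle : 0 ≤ ⟪B 1, x - x₀⟫ - τ := by
      rw [sub_self, zero_mul, zero_add] at k0
      exact nonneg_of_mul_nonneg_right k0 ht.1
    refine ⟨by linarith, ?_⟩
    have hmul := mul_le_mul_of_nonneg_right ht.2.le hle
    refine le_trans ?_ hmul
    rcases abs_cases ⟪B 0, x - x₀⟫ with ⟨h5, -⟩ | ⟨h5, -⟩ <;> rw [h5] <;> linarith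
  obtain ⟨M, hM0, hM⟩ : ∃ M : ℝ, 0 < M ∧ ∀ x ∈ Ω, ⟪B 1, x - x₀⟫ ≤ M := by
    obtain ⟨R, hR⟩ := (isBounded_iff_subset_closedBall x₀).1 hΩb
    refine ⟨max R 1, by positivity, fun x hx => le_max_of_le_left ?_⟩
    have := hR hx
    rw [mem_closedBall, dist_eq_norm] at this
    refine le_trans ?_ this
    simpa using real_inner_le_norm (B 1) (x - x₀)
  have hφc : Continuous φ := by
    have := hLip.continuous
    fun_prop
  have hφconv : ConvexOn ℝ univ φ := by
    have h1 : ConvexOn ℝ univ fun τ : ℝ => u (AffineMap.lineMap x₀ (x₀ + B 1) τ) :=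
      hconv.comp_affineMap (AffineMap.lineMap (k := ℝ) x₀ (x₀ + B 1))
    have h2 : ConcaveOn ℝ univ fun τ : ℝ => u x₀ + τ * ⟪B 1, z⟫ := by
      refine ⟨convex_univ, fun a _ b _ s t _ _ hst => le_of_eq ?_⟩
      simp only [smul_eq_mul]
      linear_combination u x₀ * hst
    refine (h1.sub h2).congr fun τ _ => ?_
    simp only [hφ, Pi.sub_apply, AffineMap.lineMap_apply_module']
    rw [add_sub_cancel_left, add_comm (τ • B 1)]
    ring
  have hclosed : IsClosed {τ | φ τ ≤ 0} := isClosed_le hφc continuous_const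
  have hzero : (0 : ℝ) ∈ {τ | φ τ ≤ 0} := by simp [hφ]
  have hbdd : BddAbove {τ | φ τ ≤ 0} := by
    have hne : (G (r / 2)).Nonempty := by
      apply nonempty_of_measure_ne_zero (μ := volume)
      rw [hvolG _ (by linarith) le_rfl]
      exact (ENNReal.ofReal_pos.2 (by positivity)).ne'
    obtain ⟨x, hx⟩ := hne
    exact ⟨_, fun τ hτ => (hmono _ x hx τ hτ).1⟩
  set c := sSup {τ | φ τ ≤ 0} with hc
  have hcmem : φ c ≤ 0 := hclosed.csSup_mem ⟨0, hzero⟩ hbdd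
  have hc0 : 0 ≤ c := le_csSup hbdd hzero
  have hη : 0 < φ (c + δ / 2) := by
    by_contra! hcon
    have := le_csSup hbdd hcon
    linarith
  set C : ℝ := (K + (|⟪B 0, z⟫| + δ)) * (M / δ) + M with hC
  have hC0 : 0 < C := by positivity
  obtain ⟨h, hh0, hhr, hhC⟩ : ∃ h, 0 < h ∧ h ≤ r / 2 ∧ h * C < φ (c + δ / 2) := by
    refine ⟨min (r / 2) (φ (c + δ / 2) / (2 * C)), by positivity, min_le_left _ _, ?_⟩
    calc _ ≤ φ (c + δ / 2) / (2 * C) * C := by gcongr; exact min_le_right _ _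
      _ = φ (c + δ / 2) / 2 := by field_simp
      _ < _ := by linarith
  have hsub : G h ⊆ {x | ⟪B 0, x⟫ ∈ Icc (⟪B 0, x₀⟫ - h / 2) (⟪B 0, x₀⟫ + h / 2) ∧
      ⟪B 1, x⟫ ∈ Icc (⟪B 1, x₀⟫ + c) (⟪B 1, x₀⟫ + c + δ / 2)} := by
    intro x hx
    obtain ⟨hc1, hc2⟩ := hmono h x hx c hcmem
    have hxM := hM x hx.1
    have hX : ⟪B 1, x - x₀⟫ < c + δ / 2 := by
      by_contra! hcon
      have hq : φ (c + δ / 2) ≤ φ ⟪B 1, x - x₀⟫ := by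
        have h1 := hφconv.le_max_of_mem_Icc (mem_univ c) (mem_univ ⟪B 1, x - x₀⟫)
          (show c + δ / 2 ∈ Icc c ⟪B 1, x - x₀⟫ from ⟨by linarith, hcon⟩)
        rcases le_max_iff.1 h1 with h2 | h2
        · linarith
        · exact h2
      obtain ⟨-, hdx, ⟨h1, h2⟩, h3, h4⟩ := hx
      have hy := gradient_mem_subdiff hconv hdx
      set y := gradient u x
      have hup := sub_le_of_mem_subdiff hLip B (x₀ := x₀) (z := z) hy
      have hX1 : |⟪B 0, x - x₀⟫| ≤ h * (M / δ) := by
        rw [← mul_div_assoc, le_div_iff₀ hδ]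
        nlinarith
      have hy1 : |⟪B 0, y⟫| ≤ |⟪B 0, z⟫| + δ := by
        have : |⟪B 0, y⟫ - ⟪B 0, z⟫| ≤ δ := abs_le.2 ⟨by linarith, by linarith⟩
        linarith [abs_sub_abs_le_abs_sub ⟪B 0, y⟫ ⟪B 0, z⟫]
      have h5 : (K + |⟪B 0, y⟫|) * |⟪B 0, x - x₀⟫| ≤ (K + (|⟪B 0, z⟫| + δ)) * (h * (M / δ)) := by
        gcongr
      have h6 : ⟪B 1, y - z⟫ * ⟪B 1, x - x₀⟫ ≤ h * M := by
        rw [inner_sub_right (B 1) y z]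
        exact mul_le_mul (by linarith) hxM (by linarith) hh0.le
      have h7 : φ ⟪B 1, x - x₀⟫ ≤ h * C := by
        refine hup.trans ?_
        rw [hC]
        linarith
      linarith
    have hX1 : |⟪B 0, x - x₀⟫| ≤ h / 2 := by
      refine le_of_mul_le_mul_left (hc2.trans ?_) hδ
      nlinarith
    rw [abs_le, inner_sub_right] at hX1
    rw [inner_sub_right] at hc1 hX
    exact ⟨⟨by linarith, by linarith⟩, by linarith, by linarith⟩
  have hle := measure_mono (μ := volume) hsub
  rw [hvolG h hh0 hhr, volume_inner_mem_box B measurableSet_Icc measurableSet_Icc,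
    Real.volume_Icc, Real.volume_Icc, ← ENNReal.ofReal_mul (by linarith),
    ENNReal.ofReal_le_ofReal_iff (by ring_nf; positivity)] at hle
  nlinarith [mul_pos hδ hh0]

theorem exists_orthonormalBasis_zero_eq {e : E2} (he : ‖e‖ = 1) :
    ∃ B : OrthonormalBasis (Fin 2) ℝ E2, B 0 = e := by
  have hee : e 0 ^ 2 + e 1 ^ 2 = 1 := by
    have := real_inner_self_eq_norm_sq e
    rw [he, PiLp.inner_apply, Fin.sum_univ_two] at this
    simpa using this
  obtain ⟨B, hB, -⟩ := exists_orthonormalBasis_eq (n := !₂[-e 1, e 0]) he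
    (by rw [EuclideanSpace.norm_eq, Fin.sum_univ_two]; simp; linarith)
    (by rw [PiLp.inner_apply, Fin.sum_univ_two]; simp; ring)
  exact ⟨B, hB⟩

theorem convex_subdiff (u : E2 → ℝ) (x : E2) : Convex ℝ (subdiff u x) := by
  intro a ha c hc s t hs ht hst z
  have h1 := mul_le_mul_of_nonneg_left (ha z) hs
  have h2 := mul_le_mul_of_nonneg_left (hc z) ht
  rw [inner_add_left, real_inner_smul_left, real_inner_smul_left]
  linear_combination h1 + h2 + (u z - u x) * hst

/-- Near some point of a nondegenerate segment contained in a finite union of segments, the union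
is contained in the line carrying that segment. -/
theorem exists_mem_openSegment_ball_subset {m : ℕ} (a c : Fin m → E2) {p q : E2} (hpq : p ≠ q)
    (n : E2) (hn : ⟪n, q - p⟫ = 0) :
    ∃ z ∈ openSegment ℝ p q, ∃ r > 0,
      ∀ y ∈ ball z r, y ∈ (⋃ j, segment ℝ (a j) (c j)) → ⟪n, y - z⟫ = 0 := by
  set J : Set (Fin m) := {j | ¬ ∀ y ∈ segment ℝ (a j) (c j), ⟪n, y - p⟫ = 0} with hJ
  set F : Set E2 := ⋃ j ∈ J, segment ℝ (a j) (c j) with hF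
  have hFclosed : IsClosed F := by
    refine (toFinite J).isClosed_biUnion fun j _ => ?_
    rw [← convexHull_pair]
    exact ((toFinite {a j, c j}).isCompact_convexHull (𝕜 := ℝ)).isClosed
  have hfin : (F ∩ {y | ⟪n, y - p⟫ = 0}).Finite := by
    rw [hF, iUnion₂_inter]
    refine (toFinite J).biUnion fun j hj => ?_
    exact ((inner_eq_zero_or_subsingleton n p (a j) (c j)).resolve_left hj).finite
  have hline : ∀ z ∈ openSegment ℝ p q, ⟪n, z - p⟫ = 0 := by
    rw [openSegment_eq_image']
    rintro _ ⟨θ, -, rfl⟩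
    rw [add_sub_cancel_left, inner_smul_right, hn, mul_zero]
  have hinf : (openSegment ℝ p q).Infinite := by
    rw [openSegment_eq_image_lineMap]
    exact (Ioo_infinite zero_lt_one).image (AffineMap.lineMap_injective ℝ hpq).injOn
  obtain ⟨z, hz, hzF⟩ := hinf.exists_notMem_finite hfin
  have hzF' : z ∈ Fᶜ := fun h => hzF ⟨h, hline z hz⟩
  obtain ⟨r, hr, hball⟩ := Metric.isOpen_iff.1 hFclosed.isOpen_compl z hzF'
  refine ⟨z, hz, r, hr, fun y hy hyU => ?_⟩
  obtain ⟨j, hj⟩ := mem_iUnion.1 hyU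
  have hjJ : j ∉ J := fun h => hball hy (mem_biUnion h hj)
  have h1 : ⟪n, y - p⟫ = 0 := not_not.1 hjJ y hj
  rw [← sub_sub_sub_cancel_right y z p, inner_sub_right, h1, hline z hz, sub_zero]

/-- If the frontier of an open set is flat near one of its points, the set contains one of the two
half-balls there. -/
theorem exists_halfBall_subset {U : Set E2} (hU : IsOpen U) {z n : E2} {r : ℝ} (hr : 0 < r)
    (hn : n ≠ 0) (hz : z ∈ frontier U) (hflat : ∀ y ∈ ball z r, y ∈ frontier U → ⟪n, y - z⟫ = 0) :
    (∀ y ∈ ball z r, 0 < ⟪n, y - z⟫ → y ∈ U) ∨ (∀ y ∈ ball z r, 0 < ⟪-n, y - z⟫ → y ∈ U) := by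
  have hside : ∀ k : E2, (k = n ∨ k = -n) →
      (∀ y ∈ ball z r, 0 < ⟪k, y - z⟫ → y ∈ U) ∨ ∀ y ∈ ball z r, 0 < ⟪k, y - z⟫ → y ∉ U := by
    intro k hk
    have hconv : Convex ℝ (ball z r ∩ {y | 0 < ⟪k, y - z⟫}) := by
      refine (convex_ball z r).inter ?_
      have := convex_halfSpace_gt (𝕜 := ℝ) (f := fun y : E2 => ⟪k, y⟫)
        ⟨fun _ _ => inner_add_right _ _ _, fun _ _ => inner_smul_right _ _ _⟩ ⟪k, z⟫
      simpa only [inner_sub_right, sub_pos] using this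
    rcases subset_or_disjoint_of_disjoint_frontier hU hconv.isPreconnected (by
      rw [Set.disjoint_left]
      rintro y ⟨hy, hky⟩ hyf
      have := hflat y hy hyf
      rcases hk with rfl | rfl
      · exact hky.ne' this
      · rw [mem_ofPred_eq, inner_neg_left, this, neg_zero] at hky
        exact lt_irrefl _ hky) with h | h
    · exact Or.inl fun y hy hky => h ⟨hy, hky⟩
    · exact Or.inr fun y hy hky => Set.disjoint_left.1 h ⟨hy, hky⟩
  rcases hside n (Or.inl rfl) with h1 | h1
  · exact Or.inl h1
  rcases hside (-n) (Or.inr rfl) with h2 | h2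
  · exact Or.inr h2
  exfalso
  obtain ⟨y, hyb, hyU⟩ := mem_closure_iff.1 hz.1 _ isOpen_ball (mem_ball_self hr)
  have hopen : IsOpen (ball z r ∩ U) := isOpen_ball.inter hU
  have hflat' : ∀ w ∈ ball z r ∩ U, ⟪n, w - z⟫ = 0 := by
    rintro w ⟨hwb, hwU⟩
    refine le_antisymm (not_lt.1 fun h => h1 w hwb h hwU) (not_lt.1 fun h => h2 w hwb ?_ hwU)
    rw [inner_neg_left]
    linarith
  have hcont : Filter.Tendsto (fun t : ℝ => y + t • n) (nhdsWithin 0 (Ioi 0)) (nhds y) := by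
    have : Continuous fun t : ℝ => y + t • n := by fun_prop
    simpa using (this.tendsto 0).mono_left nhdsWithin_le_nhds
  obtain ⟨t, ht, ht0⟩ := ((hcont.eventually (hopen.mem_nhds ⟨hyb, hyU⟩)).and
    self_mem_nhdsWithin).exists
  have h3 := hflat' _ ht
  have h4 := hflat' y ⟨hyb, hyU⟩
  rw [add_sub_right_comm, inner_add_right, h4, zero_add, inner_smul_right,
    real_inner_self_eq_norm_sq] at h3
  have : 0 < t * ‖n‖ ^ 2 := mul_pos ht0 (by positivity)
  exact this.ne' h3

/-- an extreme point `p` of `∂⁻u(x₀)` on an edge `[bᵢ, bᵢ₊₁]` is the only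
point of `∂⁻u(x₀)` on that edge. -/
theorem subdifferential_meets_edge_once
    (Ω Ωs : Set E2)
    (hΩo : IsOpen Ω) (hΩb : Bornology.IsBounded Ω) (hΩc : IsConnected Ω)
    (hΩso : IsOpen Ωs) (hΩsb : Bornology.IsBounded Ωs) (hΩsc : IsConnected Ωs)
    (hΩsnc : ¬ Convex ℝ Ωs)
    (m : ℕ) [NeZero m] (b : Fin m → E2) (hbinj : Function.Injective b)
    (hpoly : frontier Ωs = ⋃ i : Fin m, segment ℝ (b i) (b (i + 1)))
    (hvol : volume Ω = volume Ωs)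
    (u : E2 → ℝ) (hconv : ConvexOn ℝ Set.univ u)
    (K : ℝ≥0) (hLip : LipschitzWith K u)
    (hae : ∀ᵐ x : E2, DifferentiableAt ℝ u x ∧ gradient u x ∈ closure Ωs)
    (hpush : ∀ E : Set E2, MeasurableSet E →
      volume {x ∈ Ω | DifferentiableAt ℝ u x ∧ gradient u x ∈ E} = volume (E ∩ Ωs))
    (A : Set E2) (hA : A = {x ∈ Ω | ¬ DifferentiableAt ℝ u x})
    (x₀ : E2) (hx₀ : x₀ ∈ A)
    (p : E2) (hp : p ∈ Set.extremePoints ℝ (subdiff u x₀))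
    (i : Fin m) (hpe : p ∈ segment ℝ (b i) (b (i + 1))) :
    subdiff u x₀ ∩ segment ℝ (b i) (b (i + 1)) = {p} := by
  rw [eq_singleton_iff_unique_mem]
  refine ⟨⟨hp.1, hpe⟩, ?_⟩
  rintro q ⟨hq, hqe⟩
  by_contra hqp
  have hpq : p ≠ q := Ne.symm hqp
  have hnorm : 0 < ‖q - p‖ := norm_pos_iff.2 (sub_ne_zero.2 hqp)
  obtain ⟨B, hB⟩ := exists_orthonormalBasis_zero_eq (e := (‖q - p‖)⁻¹ • (q - p))
    (by rw [norm_smul, norm_inv, norm_norm, inv_mul_cancel₀ hnorm.ne'])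
  have hqB : q - p = ‖q - p‖ • B 0 := by rw [hB, smul_inv_smul₀ hnorm.ne']
  have hn : ⟪B 1, q - p⟫ = 0 := by
    rw [hqB, inner_smul_right, B.orthonormal.2 (by decide), mul_zero]
  obtain ⟨z, hz, r, hr, hflat⟩ :=
    exists_mem_openSegment_ball_subset b (fun j => b (j + 1)) hpq (B 1) hn
  rw [← hpoly] at hflat
  have hzf : z ∈ frontier Ωs := by
    rw [hpoly]
    exact mem_iUnion.2 ⟨i, (convex_segment _ _).segment_subset hpe hqe
      (openSegment_subset_segment ℝ p q hz)⟩
  obtain ⟨δ, hδ, hδr, hδz⟩ : ∃ δ > 0, δ < r / 2 ∧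
      ∀ σ : ℝ, |σ| ≤ 2 * δ → z + σ • B 0 ∈ subdiff u x₀ := by
    rw [openSegment_eq_image'] at hz
    obtain ⟨θ, ⟨hθ0, hθ1⟩, rfl⟩ := hz
    have hpos : 0 < min θ (1 - θ) := lt_min hθ0 (by linarith)
    refine ⟨min (r / 4) (min θ (1 - θ) * ‖q - p‖ / 2), by positivity,
      (min_le_left _ _).trans_lt (by linarith), fun σ hσ => ?_⟩
    have hσ' : |σ / ‖q - p‖| ≤ min θ (1 - θ) := by
      rw [abs_div, abs_norm, div_le_iff₀ hnorm]
      linarith [min_le_right (r / 4) (min θ (1 - θ) * ‖q - p‖ / 2)]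
    obtain ⟨h1, h2⟩ := abs_le.1 hσ'
    refine (convex_subdiff u x₀).segment_subset hp.1 hq ?_
    rw [segment_eq_image']
    refine ⟨θ + σ / ‖q - p‖, ⟨by linarith [min_le_left θ (1 - θ)],
      by linarith [min_le_right θ (1 - θ)]⟩, ?_⟩
    simp only [hB, add_smul, smul_smul, div_eq_mul_inv, add_assoc]
  rcases exists_halfBall_subset hΩso hr (B.orthonormal.ne_zero 1) hzf hflat with h | h
  · exact false_of_halfBall_subset hΩb hconv hLip hpush B hδ hδr hδz h
  · obtain ⟨B', h0, h1⟩ := exists_orthonormalBasis_eq (e := B 0) (n := -B 1) (by simp) (by simp)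
      (by rw [inner_neg_right, B.orthonormal.2 (by decide), neg_zero])
    rw [← h1] at h
    rw [← h0] at hδz
    exact false_of_halfBall_subset hΩb hconv hLip hpush B' hδ hδr hδz h
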